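/- Under Condition 3 with 0 < d₁ < 1, there exists ζ₀ > 0 such that for every ζ ∈ (0, ζ₀) the following holds for all sufficiently large p: if γ̂_1 ≥ γ̂_2 ≥ … ≥ γ̂_p > 0 are reals with |γ̂_j − γ_j| ≤ p^{ζ − 2/3}·(min(j, p+1−j))^{−1/3} for every 1 ≤ j ≤ p, then there exists ĉ_p ∈ (0, γ̂_p) with (1/p)·Σ_{j=1}^p ( ĉ_p/(γ̂_j − ĉ_p) )² = n/p, satisfying c_{p,0} − p^{−1/2} < ĉ_p < c_{p,0} + p^{−1/2} and |c_{p,0} − ĉ_p| ≤ M·p^{ζ−1} for a constant M independent of p; moreover sup_p ĉ_p/(γ̂_p − ĉ_p) < ∞ and limsup_p ĉ_p/γ̂_p < 1. -/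

import Mathlib

open MeasureTheory Filter

/-- Left edge of the Marchenko–Pastur type law with ratio `d`. -/
noncomputable def aMP (d : ℝ) : ℝ := (1 - Real.sqrt d) ^ 2

/-- Right edge of the Marchenko–Pastur type law with ratio `d`. -/
noncomputable def bMP (d : ℝ) : ℝ := (1 + Real.sqrt d) ^ 2

/-- The Marchenko–Pastur type density `ϱ_d`. -/
noncomputable def rhoMP (d x : ℝ) : ℝ :=
  if aMP d ≤ x ∧ x ≤ bMP d then
    (1 / (2 * Real.pi * d * x)) * Real.sqrt ((bMP d - x) * (x - aMP d))
  else 0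

theorem sum_rpow_neg_third_le (p : ℕ) :
    ∑ j ∈ Finset.Icc 1 p, (j : ℝ) ^ (-(1 : ℝ) / 3) ≤ 3 / 2 * (p : ℝ) ^ ((2 : ℝ) / 3) := by
  induction p with
  | zero => simp
  | succ k ih =>
    rw [Finset.sum_Icc_succ_top (by omega)]
    have hk : (0 : ℝ) ≤ k := k.cast_nonneg
    set u : ℝ := ((k + 1 : ℕ) : ℝ) ^ ((1 : ℝ) / 3) with hu
    set v : ℝ := (k : ℝ) ^ ((1 : ℝ) / 3) with hv
    have hu0 : 0 < u := by positivity
    have hv0 : 0 ≤ v := by positivity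
    have hu3 : u ^ 3 = k + 1 := by
      rw [hu, ← Real.rpow_natCast, ← Real.rpow_mul (by positivity)]; norm_num
    have hv3 : v ^ 3 = k := by
      rw [hv, ← Real.rpow_natCast, ← Real.rpow_mul (by positivity)]; norm_num
    have h1 : ((k + 1 : ℕ) : ℝ) ^ ((2 : ℝ) / 3) = u ^ 2 := by
      rw [hu, ← Real.rpow_natCast, ← Real.rpow_mul (by positivity)]; norm_num
    have h2 : (k : ℝ) ^ ((2 : ℝ) / 3) = v ^ 2 := by
      rw [hv, ← Real.rpow_natCast, ← Real.rpow_mul (by positivity)]; norm_num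
    have h3 : ((k + 1 : ℕ) : ℝ) ^ (-(1 : ℝ) / 3) = u⁻¹ := by
      rw [hu, ← Real.rpow_neg (by positivity)]; norm_num
    rw [h1, h3]
    rw [h2] at ih
    have h4 : u⁻¹ ≤ 3 / 2 * (u ^ 2 - v ^ 2) := by
      rw [inv_le_iff_one_le_mul₀ hu0]
      nlinarith [mul_nonneg (sq_nonneg (u - v)) (by positivity : 0 ≤ u + 2 * v)]
    linarith

theorem sum_min_rpow_neg_third_le (p : ℕ) :
    ∑ j ∈ Finset.Icc 1 p, ((min j (p + 1 - j) : ℕ) : ℝ) ^ (-(1 : ℝ) / 3)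
      ≤ 3 * (p : ℝ) ^ ((2 : ℝ) / 3) := by
  have hrefl : ∑ j ∈ Finset.Icc 1 p, ((p + 1 - j : ℕ) : ℝ) ^ (-(1 : ℝ) / 3)
      = ∑ j ∈ Finset.Icc 1 p, (j : ℝ) ^ (-(1 : ℝ) / 3) := by
    refine Finset.sum_nbij' (fun j => p + 1 - j) (fun j => p + 1 - j) ?_ ?_ ?_ ?_ ?_
    all_goals intro j hj
    all_goals simp only [Finset.mem_Icc] at hj ⊢
    all_goals omega
  calc ∑ j ∈ Finset.Icc 1 p, ((min j (p + 1 - j) : ℕ) : ℝ) ^ (-(1 : ℝ) / 3)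
      ≤ ∑ j ∈ Finset.Icc 1 p, ((j : ℝ) ^ (-(1 : ℝ) / 3)
          + ((p + 1 - j : ℕ) : ℝ) ^ (-(1 : ℝ) / 3)) := by
        refine Finset.sum_le_sum fun j _ => ?_
        rcases min_choice j (p + 1 - j) with h | h <;> rw [h]
        · exact le_add_of_nonneg_right (by positivity)
        · exact le_add_of_nonneg_left (by positivity)
    _ ≤ 3 * (p : ℝ) ^ ((2 : ℝ) / 3) := by
        rw [Finset.sum_add_distrib, hrefl]
        linarith [sum_rpow_neg_third_le p]

theorem hasDerivAt_sqrt_mul_div_primitive {a b x : ℝ} (ha : 0 < a) (hx : x ∈ Set.Ioo a b) :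
    HasDerivAt (fun y => Real.sqrt ((b - y) * (y - a))
      + (a + b) / 2 * Real.arcsin ((2 * y - a - b) / (b - a))
      - Real.sqrt (a * b) * Real.arcsin (((a + b) * y - 2 * a * b) / (y * (b - a))))
      (Real.sqrt ((b - x) * (x - a)) / x) x := by
  obtain ⟨hxa, hxb⟩ := hx
  have hx0 : 0 < x := ha.trans hxa
  have hb : 0 < b := hx0.trans hxb
  have hba : 0 < b - a := by linarith
  have hP : 0 < (b - x) * (x - a) := mul_pos (by linarith) (by linarith)
  set S := Real.sqrt ((b - x) * (x - a))
  have hS0 : 0 < S := Real.sqrt_pos.2 hP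
  have hS2 : S ^ 2 = (b - x) * (x - a) := Real.sq_sqrt hP.le
  set q := Real.sqrt (a * b)
  have hq0 : 0 < q := Real.sqrt_pos.2 (by positivity)
  have hq2 : q ^ 2 = a * b := Real.sq_sqrt (by positivity)
  have e1 : 1 - ((2 * x - a - b) / (b - a)) ^ 2 = (2 * S / (b - a)) ^ 2 := by
    field_simp; rw [hS2]; ring
  have e2 : 1 - (((a + b) * x - 2 * a * b) / (x * (b - a))) ^ 2
      = (2 * q * S / (x * (b - a))) ^ 2 := by
    field_simp; rw [hS2, hq2]; ring
  have d1 : HasDerivAt (fun y => Real.sqrt ((b - y) * (y - a)))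
      ((a + b - 2 * x) / (2 * S)) x := by
    have h : HasDerivAt (fun y : ℝ => (b - y) * (y - a)) (a + b - 2 * x) x := by
      have := ((hasDerivAt_id x).const_sub b).mul ((hasDerivAt_id x).sub_const a)
      refine this.congr_deriv ?_
      simp; ring
    exact h.sqrt hP.ne'
  have n1 : 0 < 1 - ((2 * x - a - b) / (b - a)) ^ 2 := by rw [e1]; positivity
  have n2 : 0 < 1 - (((a + b) * x - 2 * a * b) / (x * (b - a))) ^ 2 := by rw [e2]; positivity
  have d2 : HasDerivAt (fun y => Real.arcsin ((2 * y - a - b) / (b - a))) (1 / S) x := by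
    have h : HasDerivAt (fun y : ℝ => (2 * y - a - b) / (b - a)) (2 / (b - a)) x := by
      have := ((((hasDerivAt_id x).const_mul 2).sub_const a).sub_const b).div_const (b - a)
      simpa using this
    have := (Real.hasDerivAt_arcsin (x := (2 * x - a - b) / (b - a))
      (by rintro h; rw [h] at n1; norm_num at n1)
      (by rintro h; rw [h] at n1; norm_num at n1)).comp x h
    refine this.congr_deriv ?_
    rw [e1, Real.sqrt_sq (by positivity)]
    field_simp
  have d3 : HasDerivAt (fun y => Real.arcsin (((a + b) * y - 2 * a * b) / (y * (b - a))))
      (q / (x * S)) x := by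
    have h : HasDerivAt (fun y : ℝ => ((a + b) * y - 2 * a * b) / (y * (b - a)))
        (2 * q ^ 2 / (x ^ 2 * (b - a))) x := by
      have := (((hasDerivAt_id x).const_mul (a + b)).sub_const (2 * a * b)).div
        ((hasDerivAt_id x).mul_const (b - a)) (by simp; exact ⟨hx0.ne', hba.ne'⟩)
      refine this.congr_deriv ?_
      simp only [id, mul_one, one_mul]
      rw [hq2]
      field_simp
      ring
    have := (Real.hasDerivAt_arcsin (x := ((a + b) * x - 2 * a * b) / (x * (b - a)))
      (by rintro h; rw [h] at n2; norm_num at n2)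
      (by rintro h; rw [h] at n2; norm_num at n2)).comp x h
    refine this.congr_deriv ?_
    rw [e2, Real.sqrt_sq (by positivity)]
    field_simp
  refine ((d1.add (d2.const_mul ((a + b) / 2))).sub (d3.const_mul q)).congr_deriv ?_
  field_simp
  rw [hS2, hq2]
  ring

theorem integral_sqrt_mul_div {a b : ℝ} (ha : 0 < a) (hab : a < b) :
    ∫ x in a..b, Real.sqrt ((b - x) * (x - a)) / x
      = Real.pi * ((a + b) / 2 - Real.sqrt (a * b)) := by
  have hba : 0 < b - a := by linarith
  have hb : 0 < b := ha.trans hab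
  have hne : ∀ x ∈ Set.Icc a b, x ≠ 0 := fun x hx => (ha.trans_le hx.1).ne'
  rw [intervalIntegral.integral_eq_sub_of_hasDerivAt_of_le hab.le (f := fun y =>
      Real.sqrt ((b - y) * (y - a)) + (a + b) / 2 * Real.arcsin ((2 * y - a - b) / (b - a))
      - Real.sqrt (a * b) * Real.arcsin (((a + b) * y - 2 * a * b) / (y * (b - a))))]
  · have h1 : (2 * b - a - b) / (b - a) = 1 := by field_simp; ring
    have h2 : (2 * a - a - b) / (b - a) = -1 := by field_simp; ring
    have h3 : ((a + b) * b - 2 * a * b) / (b * (b - a)) = 1 := by field_simp; ring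
    have h4 : ((a + b) * a - 2 * a * b) / (a * (b - a)) = -1 := by field_simp; ring
    simp only [h1, h2, h3, h4, Real.arcsin_one, Real.arcsin_neg_one]
    simp
    ring
  · refine ContinuousOn.sub (by fun_prop) (ContinuousOn.mul (by fun_prop) ?_)
    refine Real.continuous_arcsin.comp_continuousOn (ContinuousOn.div (by fun_prop) (by fun_prop) ?_)
    intro x hx
    exact mul_ne_zero (hne x hx) hba.ne'
  · exact fun x hx => hasDerivAt_sqrt_mul_div_primitive ha hx
  · refine ContinuousOn.intervalIntegrable ?_
    rw [Set.uIcc_of_le hab.le]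
    exact ContinuousOn.div (by fun_prop) (by fun_prop) hne

theorem aMP_pos {d : ℝ} (h1 : d < 1) : 0 < aMP d := by
  have : Real.sqrt d < 1 := by rw [Real.sqrt_lt' one_pos]; simpa using h1
  unfold aMP
  have : 0 < 1 - Real.sqrt d := by linarith
  positivity

theorem bMP_sub_aMP (d : ℝ) : bMP d - aMP d = 4 * Real.sqrt d := by
  unfold aMP bMP; ring

theorem aMP_lt_bMP {d : ℝ} (h0 : 0 < d) : aMP d < bMP d := by
  have := bMP_sub_aMP d
  have := Real.sqrt_pos.2 h0
  linarith

theorem aMP_le_one {d : ℝ} (h1 : d < 1) : aMP d ≤ 1 := by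
  have : Real.sqrt d < 1 := by rw [Real.sqrt_lt' one_pos]; simpa using h1
  unfold aMP
  nlinarith [Real.sqrt_nonneg d]

theorem bMP_le_four {d : ℝ} (h1 : d < 1) : bMP d ≤ 4 := by
  have : Real.sqrt d < 1 := by rw [Real.sqrt_lt' one_pos]; simpa using h1
  unfold bMP
  nlinarith [Real.sqrt_nonneg d]

theorem continuousOn_rhoMP {d : ℝ} (h0 : 0 < d) (h1 : d < 1) :
    ContinuousOn (rhoMP d) (Set.Icc (aMP d) (bMP d)) := by
  have hne : ∀ x ∈ Set.Icc (aMP d) (bMP d), 2 * Real.pi * d * x ≠ 0 := fun x hx => by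
    have := (aMP_pos h1).trans_le hx.1
    positivity
  refine ContinuousOn.congr
    (f := fun x => (1 / (2 * Real.pi * d * x)) * Real.sqrt ((bMP d - x) * (x - aMP d))) ?_ ?_
  · exact (ContinuousOn.div (by fun_prop) (by fun_prop) hne).mul (by fun_prop)
  · intro x hx
    exact if_pos hx

theorem rhoMP_nonneg {d : ℝ} (h0 : 0 < d) (h1 : d < 1) (x : ℝ) : 0 ≤ rhoMP d x := by
  unfold rhoMP
  split_ifs with h
  · have := (aMP_pos h1).trans_le h.1
    positivity
  · rfl

theorem intervalIntegrable_rhoMP {d u v : ℝ} (h0 : 0 < d) (h1 : d < 1)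
    (hu : u ∈ Set.Icc (aMP d) (bMP d)) (hv : v ∈ Set.Icc (aMP d) (bMP d)) :
    IntervalIntegrable (rhoMP d) volume u v :=
  ((continuousOn_rhoMP h0 h1).mono (Set.uIcc_subset_Icc hu hv)).intervalIntegrable

theorem integral_rhoMP {d : ℝ} (h0 : 0 < d) (h1 : d < 1) :
    ∫ x in (aMP d)..(bMP d), rhoMP d x = 1 := by
  have hlt : Real.sqrt d < 1 := by rw [Real.sqrt_lt' one_pos]; simpa using h1
  have hsq : Real.sqrt d ^ 2 = d := Real.sq_sqrt h0.le
  have hab : Real.sqrt (aMP d * bMP d) = 1 - d := by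
    rw [show aMP d * bMP d = (1 - d) ^ 2 by
      unfold aMP bMP; rw [← mul_pow]; congr 1; linear_combination -hsq]
    exact Real.sqrt_sq (by linarith)
  have hsum : aMP d + bMP d = 2 * (1 + d) := by
    unfold aMP bMP; linear_combination 2 * hsq
  calc ∫ x in (aMP d)..(bMP d), rhoMP d x
      = ∫ x in (aMP d)..(bMP d),
          1 / (2 * Real.pi * d) * (Real.sqrt ((bMP d - x) * (x - aMP d)) / x) := by
        refine intervalIntegral.integral_congr fun x hx => ?_
        rw [Set.uIcc_of_le (aMP_lt_bMP h0).le] at hx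
        have := (aMP_pos h1).trans_le hx.1
        simp only [rhoMP]
        rw [if_pos (Set.mem_Icc.1 hx)]
        field_simp
    _ = 1 := by
        rw [intervalIntegral.integral_const_mul, integral_sqrt_mul_div (aMP_pos h1) (aMP_lt_bMP h0),
          hab, hsum]
        field_simp
        ring

/-- The mass of the Marchenko–Pastur law near its left edge is at least of order `s ^ (3 / 2)`. -/
theorem le_integral_rhoMP_left_edge {d l s : ℝ} (h0 : 0 < d) (h1 : d < 1) (hl : l ≤ Real.sqrt d)
    (hs : 0 < s) (hsl : s ≤ 2 * l) :
    s * Real.sqrt (l * s) / (16 * Real.pi) ≤ ∫ x in (aMP d)..(aMP d + s), rhoMP d x := by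
  have hba := bMP_sub_aMP d
  have ha := aMP_pos h1
  have hmem : ∀ t, 0 ≤ t → t ≤ s → aMP d + t ∈ Set.Icc (aMP d) (bMP d) := fun t ht hts =>
    ⟨by linarith, by linarith⟩
  have hi : ∀ t, 0 ≤ t → t ≤ s → ∀ t', 0 ≤ t' → t' ≤ s →
      IntervalIntegrable (rhoMP d) volume (aMP d + t) (aMP d + t') := fun t h h' t' k k' =>
    intervalIntegrable_rhoMP h0 h1 (hmem t h h') (hmem t' k k')
  have hi1 := hi 0 le_rfl hs.le (s / 2) (by linarith) (by linarith)
  have hi2 := hi (s / 2) (by linarith) (by linarith) s hs.le le_rfl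
  rw [add_zero] at hi1
  rw [← intervalIntegral.integral_add_adjacent_intervals hi1 hi2]
  have hnn : 0 ≤ ∫ x in (aMP d)..(aMP d + s / 2), rhoMP d x :=
    intervalIntegral.integral_nonneg (by linarith) fun x _ => rhoMP_nonneg h0 h1 x
  have hlow : ∫ _ in (aMP d + s / 2)..(aMP d + s), 1 / (8 * Real.pi) * Real.sqrt (l * s)
      ≤ ∫ x in (aMP d + s / 2)..(aMP d + s), rhoMP d x := by
    refine intervalIntegral.integral_mono_on (by linarith) (by simp) hi2 fun x hx => ?_
    obtain ⟨hx1, hx2⟩ := hx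
    have hx0 : 0 < x := by linarith
    have hx4 : x ≤ 4 := by linarith [bMP_le_four h1]
    unfold rhoMP
    rw [if_pos ⟨by linarith, by linarith⟩]
    refine mul_le_mul (one_div_le_one_div_of_le (by positivity) ?_) (Real.sqrt_le_sqrt ?_)
      (Real.sqrt_nonneg _) (by positivity)
    · have : d * x ≤ 4 := by nlinarith
      nlinarith [Real.pi_pos]
    · nlinarith [mul_nonneg (by linarith : 0 ≤ bMP d - x - 2 * l) (by linarith : 0 ≤ x - aMP d)]
  rw [intervalIntegral.integral_const, smul_eq_mul] at hlow
  calc s * Real.sqrt (l * s) / (16 * Real.pi)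
      = (aMP d + s - (aMP d + s / 2)) * (1 / (8 * Real.pi) * Real.sqrt (l * s)) := by
        field_simp; ring
    _ ≤ _ := by linarith

theorem abs_sq_div_sub_sub_sq_div_sub_le {c g h δ : ℝ} (hδ : 0 < δ) (hc0 : 0 ≤ c) (hc1 : c ≤ 1)
    (hg : 2 * δ ≤ g - c) (hh : 2 * δ ≤ h - c) :
    |(c / (h - c)) ^ 2 - (c / (g - c)) ^ 2| ≤ |h - g| / δ ^ 3 := by
  have hg0 : 0 < g - c := by linarith
  have hh0 : 0 < h - c := by linarith
  have hfac : (c / (h - c)) ^ 2 - (c / (g - c)) ^ 2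
      = (h - g) * -(c ^ 2 * (1 / ((h - c) * (g - c))) * (1 / (h - c) + 1 / (g - c))) := by
    field_simp; ring
  rw [hfac, abs_mul, abs_neg, div_eq_mul_one_div |h - g|]
  refine mul_le_mul_of_nonneg_left ?_ (abs_nonneg _)
  rw [abs_of_nonneg (by positivity)]
  calc c ^ 2 * (1 / ((h - c) * (g - c))) * (1 / (h - c) + 1 / (g - c))
      ≤ 1 ^ 2 * (1 / ((2 * δ) * (2 * δ))) * (1 / (2 * δ) + 1 / (2 * δ)) := by gcongr
    _ = 1 / 4 * (1 / δ ^ 3) := by field_simp; norm_num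
    _ ≤ 1 / δ ^ 3 := by
      have : 0 ≤ 1 / δ ^ 3 := by positivity
      linarith

theorem le_sq_div_sub_sub_sq_div_sub {x y g : ℝ} (hx : 0 ≤ x) (hxy : x ≤ y) (hyg : y < g)
    (hg : g ≤ 4) : (y - x) * y / 16 ≤ (y / (g - y)) ^ 2 - (x / (g - x)) ^ 2 := by
  have hy : 0 < g - y := by linarith
  have hx' : 0 < g - x := by linarith
  have hg0 : 0 < g := by linarith
  have hA : y / 4 ≤ y / (g - y) :=
    div_le_div_of_nonneg_left (by linarith) hy (by linarith)
  have hB : 0 ≤ x / (g - x) := by positivity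
  have hD : (y - x) / 4 ≤ y / (g - y) - x / (g - x) := by
    have : y / (g - y) - x / (g - x) = (y - x) * (g / ((g - x) * (g - y))) := by
      field_simp; ring
    rw [this, div_eq_mul_one_div]
    refine mul_le_mul_of_nonneg_left ?_ (by linarith)
    rw [div_le_div_iff₀ (by norm_num) (by positivity)]
    nlinarith
  nlinarith [mul_le_mul hD hA (by linarith) (by linarith)]

/-- Stability, under perturbation of the points `g`, of the root of
`c ↦ (1 / p) * ∑ (c / (g j - c)) ^ 2 = ν`. -/
theorem exists_perturbed_root {p : ℕ} (hp : 0 < p) {g h : ℕ → ℝ} {c a δ l e t ν : ℝ}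
    (hδ : 0 < δ) (hl : 0 < l) (ha1 : a ≤ 1) (hlc : l ≤ c) (hca : c + 4 * δ ≤ a)
    (hg : ∀ j ∈ Finset.Icc 1 p, g j ∈ Set.Icc a 4)
    (hh : ∀ j ∈ Finset.Icc 1 p, |h j - g j| ≤ δ)
    (he : (1 / (p : ℝ)) * ∑ j ∈ Finset.Icc 1 p, |h j - g j| ≤ e)
    (ht0 : 0 ≤ t) (htδ : t ≤ δ) (htl : t < l) (het : 16 / (l * δ ^ 3) * e ≤ t)
    (hν : (1 / (p : ℝ)) * ∑ j ∈ Finset.Icc 1 p, (c / (g j - c)) ^ 2 = ν) :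
    ∃ x ∈ Set.Icc (c - t) (c + t),
      (1 / (p : ℝ)) * ∑ j ∈ Finset.Icc 1 p, (x / (h j - x)) ^ 2 = ν := by
  have hp' : (0 : ℝ) < p := by exact_mod_cast hp
  have hhl : ∀ j ∈ Finset.Icc 1 p, a - δ ≤ h j := fun j hj => by
    have := (abs_le.1 (hh j hj)).1
    have := (hg j hj).1
    linarith
  have hclose : ∀ x ∈ Set.Icc (c - t) (c + t),
      |(1 / (p : ℝ)) * ∑ j ∈ Finset.Icc 1 p, (x / (h j - x)) ^ 2
        - (1 / (p : ℝ)) * ∑ j ∈ Finset.Icc 1 p, (x / (g j - x)) ^ 2| ≤ e / δ ^ 3 := by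
    rintro x ⟨hx1, hx2⟩
    rw [← mul_sub, ← Finset.sum_sub_distrib, abs_mul, abs_of_pos (by positivity : 0 < 1 / (p : ℝ))]
    calc (1 / (p : ℝ)) * |∑ j ∈ Finset.Icc 1 p, ((x / (h j - x)) ^ 2 - (x / (g j - x)) ^ 2)|
        ≤ (1 / (p : ℝ)) * ∑ j ∈ Finset.Icc 1 p, |h j - g j| / δ ^ 3 := by
          gcongr
          refine (Finset.abs_sum_le_sum_abs _ _).trans (Finset.sum_le_sum fun j hj => ?_)
          have := hhl j hj
          have := (hg j hj).1
          exact abs_sq_div_sub_sub_sq_div_sub_le hδ (by linarith) (by linarith) (by linarith)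
            (by linarith)
      _ ≤ e / δ ^ 3 := by
          rw [← Finset.sum_div, ← mul_div_assoc]
          gcongr
  have hmono : ∀ x y, 0 ≤ x → x ≤ y → y ≤ c + t → (y - x) * y / 16
      ≤ (1 / (p : ℝ)) * ∑ j ∈ Finset.Icc 1 p, (y / (g j - y)) ^ 2
        - (1 / (p : ℝ)) * ∑ j ∈ Finset.Icc 1 p, (x / (g j - x)) ^ 2 := by
    intro x y hx hxy hy
    rw [← mul_sub, ← Finset.sum_sub_distrib]
    calc (y - x) * y / 16
        = (1 / (p : ℝ)) * ∑ j ∈ Finset.Icc 1 p, (y - x) * y / 16 := by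
          rw [Finset.sum_const, Nat.card_Icc, nsmul_eq_mul, Nat.add_sub_cancel]
          field_simp
      _ ≤ _ := by
          gcongr with j hj
          have := hg j hj
          exact le_sq_div_sub_sub_sq_div_sub hx hxy (by linarith [this.1]) this.2
  have hest : e / δ ^ 3 ≤ t * l / 16 := by
    rw [div_mul_eq_mul_div, div_le_iff₀ (by positivity)] at het
    rw [div_le_div_iff₀ (by positivity) (by norm_num)]
    linarith
  have hlt : t * l / 16 ≤ t * c / 16 := by gcongr
  have hcont : ContinuousOn
      (fun x => (1 / (p : ℝ)) * ∑ j ∈ Finset.Icc 1 p, (x / (h j - x)) ^ 2)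
      (Set.Icc (c - t) (c + t)) := by
    refine continuousOn_const.mul (continuousOn_finsetSum _ fun j hj => ?_)
    refine (continuousOn_id.div (by fun_prop) fun x hx => ?_).pow 2
    have := hhl j hj
    have := hx.2
    exact ne_of_gt (by linarith)
  have hmem : ν ∈ Set.Icc
      ((1 / (p : ℝ)) * ∑ j ∈ Finset.Icc 1 p, ((c - t) / (h j - (c - t))) ^ 2)
      ((1 / (p : ℝ)) * ∑ j ∈ Finset.Icc 1 p, ((c + t) / (h j - (c + t))) ^ 2) := by
    constructor
    · have h1 := abs_le.1 (hclose (c - t) ⟨le_rfl, by linarith⟩)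
      have h2 := hmono (c - t) c (by linarith) (by linarith) (by linarith)
      rw [hν] at h2
      have h3 : (c - (c - t)) * c / 16 = t * c / 16 := by ring
      linarith [h1.2]
    · have h1 := abs_le.1 (hclose (c + t) ⟨by linarith, le_rfl⟩)
      have h2 := hmono c (c + t) (by linarith) (by linarith) le_rfl
      rw [hν] at h2
      have h3 : (c + t - c) * (c + t) / 16 = t * c / 16 + t * t / 16 := by ring
      linarith [h1.1, mul_nonneg ht0 ht0]
  obtain ⟨x, hx, hxν⟩ := intermediate_value_Icc (by linarith : c - t ≤ c + t) hcont hmem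
  exact ⟨x, hx, hxν⟩

/-- `g` lists the Marchenko–Pastur quantiles: few of them are far from the left edge. -/
theorem quantile_le_of_lt {p : ℕ} {d s κ : ℝ} {g : ℕ → ℝ} (h0 : 0 < d) (h1 : d < 1)
    (hs : 0 < s) (hκ : κ ≤ ∫ x in (aMP d)..(aMP d + s), rhoMP d x)
    (hgp : g p = aMP d)
    (hg : ∀ j, 1 ≤ j → j ≤ p - 1 → g j ∈ Set.Ioo (aMP d) (bMP d) ∧
      ∫ x in (g j)..(bMP d), rhoMP d x = (j : ℝ) / p)
    {j : ℕ} (hj1 : 1 ≤ j) (hjp : j ≤ p) (hj : p * (1 - κ) < (j : ℝ)) :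
    g j ≤ aMP d + s := by
  rcases hjp.eq_or_lt with rfl | hlt
  · linarith
  obtain ⟨⟨hga, hgb⟩, hint⟩ := hg j hj1 (by omega)
  by_contra! hcon
  have hp : (0 : ℝ) < p := by exact_mod_cast (by omega : 0 < p)
  have hA : aMP d ∈ Set.Icc (aMP d) (bMP d) := ⟨le_rfl, (aMP_lt_bMP h0).le⟩
  have hB : bMP d ∈ Set.Icc (aMP d) (bMP d) := ⟨(aMP_lt_bMP h0).le, le_rfl⟩
  have hS : aMP d + s ∈ Set.Icc (aMP d) (bMP d) := ⟨by linarith, by linarith⟩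
  have hG : g j ∈ Set.Icc (aMP d) (bMP d) := ⟨hga.le, hgb.le⟩
  have hsplit := intervalIntegral.integral_add_adjacent_intervals
    (intervalIntegrable_rhoMP h0 h1 hA hG) (intervalIntegrable_rhoMP h0 h1 hG hB)
  have hsplit' := intervalIntegral.integral_add_adjacent_intervals
    (intervalIntegrable_rhoMP h0 h1 hA hS) (intervalIntegrable_rhoMP h0 h1 hS hG)
  have hnn : 0 ≤ ∫ x in (aMP d + s)..(g j), rhoMP d x :=
    intervalIntegral.integral_nonneg hcon.le fun x _ => rhoMP_nonneg h0 h1 x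
  rw [integral_rhoMP h0 h1, hint] at hsplit
  have : 1 - κ < (j : ℝ) / p := by rw [lt_div_iff₀ hp]; linarith
  linarith

/-- The root of `(1 / p) * ∑ (c / (g j - c)) ^ 2 = ν` stays away from the left edge. -/
theorem root_add_le_aMP {p : ℕ} (hp : 0 < p) {d s κ c ν : ℝ} {g : ℕ → ℝ} (h0 : 0 < d)
    (h1 : d < 1) (hs : 0 < s) (hκ0 : 0 ≤ κ) (hκ1 : κ ≤ 1)
    (hκ : κ ≤ ∫ x in (aMP d)..(aMP d + s), rhoMP d x)
    (hgp : g p = aMP d)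
    (hg : ∀ j, 1 ≤ j → j ≤ p - 1 → g j ∈ Set.Ioo (aMP d) (bMP d) ∧
      ∫ x in (g j)..(bMP d), rhoMP d x = (j : ℝ) / p)
    (hc : c ∈ Set.Ioo 0 (aMP d)) (hsa : 2 * s ≤ aMP d)
    (hν : (1 / (p : ℝ)) * ∑ j ∈ Finset.Icc 1 p, (c / (g j - c)) ^ 2 = ν)
    (hbig : ν < κ * (aMP d / (4 * s)) ^ 2) :
    c + s ≤ aMP d := by
  by_contra! hcon
  have hp' : (0 : ℝ) < p := by exact_mod_cast hp
  have ha := aMP_pos h1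
  have hga : ∀ j, 1 ≤ j → j ≤ p → aMP d ≤ g j := fun j hj hjp => by
    rcases hjp.eq_or_lt with rfl | hlt
    · exact hgp.ge
    · exact (hg j hj (by omega)).1.1.le
  set L := ⌊(p : ℝ) * (1 - κ)⌋₊
  have hLle : (L : ℝ) ≤ p * (1 - κ) := Nat.floor_le (mul_nonneg hp'.le (by linarith))
  have hLp : L ≤ p := by
    have : (L : ℝ) ≤ p := hLle.trans (by nlinarith)
    exact_mod_cast this
  have hsum : p * κ * (aMP d / (4 * s)) ^ 2 ≤ ∑ j ∈ Finset.Icc 1 p, (c / (g j - c)) ^ 2 := by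
    calc p * κ * (aMP d / (4 * s)) ^ 2
        ≤ ((p - L : ℕ) : ℝ) * (aMP d / (4 * s)) ^ 2 := by
          gcongr
          rw [Nat.cast_sub hLp]
          linarith
      _ = ∑ j ∈ Finset.Icc (L + 1) p, (aMP d / (4 * s)) ^ 2 := by
          rw [Finset.sum_const, Nat.card_Icc, nsmul_eq_mul, Nat.add_sub_add_right]
      _ ≤ ∑ j ∈ Finset.Icc (L + 1) p, (c / (g j - c)) ^ 2 := by
          refine Finset.sum_le_sum fun j hj => ?_
          rw [Finset.mem_Icc] at hj
          have hj1 : 1 ≤ j := by omega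
          have hlt : p * (1 - κ) < (j : ℝ) := by
            refine (Nat.lt_floor_add_one _).trans_le ?_
            exact_mod_cast hj.1
          have hle := quantile_le_of_lt h0 h1 hs hκ hgp hg hj1 hj.2 hlt
          have hge := hga j hj1 hj.2
          have hpos : 0 < g j - c := by linarith [hc.2]
          have : aMP d / (4 * s) = (aMP d / 2) / (2 * s) := by field_simp; norm_num
          rw [this]
          have : 0 ≤ c := hc.1.le
          gcongr
          · linarith
          · linarith
      _ ≤ ∑ j ∈ Finset.Icc 1 p, (c / (g j - c)) ^ 2 :=
          Finset.sum_le_sum_of_subset_of_nonneg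
            (Finset.Icc_subset_Icc (by omega) le_rfl) fun _ _ _ => sq_nonneg _
  rw [← hν, one_div, inv_mul_eq_div, div_lt_iff₀ hp'] at hbig
  linarith

theorem mul_sqrt_le_root {p : ℕ} (hp : 0 < p) {s c a ν ν₀ : ℝ} {g : ℕ → ℝ} (hs : 0 < s)
    (hc : 0 < c) (hca : c + s ≤ a) (hg : ∀ j ∈ Finset.Icc 1 p, a ≤ g j)
    (hν : (1 / (p : ℝ)) * ∑ j ∈ Finset.Icc 1 p, (c / (g j - c)) ^ 2 = ν) (hν₀ : ν₀ ≤ ν) :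
    s * Real.sqrt ν₀ ≤ c := by
  have hp' : (0 : ℝ) < p := by exact_mod_cast hp
  have hle : ν ≤ (c / s) ^ 2 := by
    rw [← hν]
    calc (1 / (p : ℝ)) * ∑ j ∈ Finset.Icc 1 p, (c / (g j - c)) ^ 2
        ≤ (1 / (p : ℝ)) * ∑ j ∈ Finset.Icc 1 p, (c / s) ^ 2 := by
          gcongr with j hj
          · have := hg j hj
            exact div_nonneg hc.le (by linarith)
          · linarith [hg j hj]
      _ = (c / s) ^ 2 := by
          rw [Finset.sum_const, Nat.card_Icc, nsmul_eq_mul, Nat.add_sub_cancel]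
          field_simp
  have := (Real.sqrt_le_sqrt (hν₀.trans hle)).trans_eq (Real.sqrt_sq (by positivity))
  rw [le_div_iff₀ hs] at this
  linarith

theorem mean_abs_sub_le {p : ℕ} (hp : 0 < p) {ζ : ℝ} {g h : ℕ → ℝ}
    (hh : ∀ j, 1 ≤ j → j ≤ p → |h j - g j|
      ≤ (p : ℝ) ^ (ζ - 2 / 3) * ((min j (p + 1 - j) : ℕ) : ℝ) ^ (-(1 : ℝ) / 3)) :
    (1 / (p : ℝ)) * ∑ j ∈ Finset.Icc 1 p, |h j - g j| ≤ 3 * (p : ℝ) ^ (ζ - 1) := by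
  have hp' : (0 : ℝ) < p := by exact_mod_cast hp
  calc (1 / (p : ℝ)) * ∑ j ∈ Finset.Icc 1 p, |h j - g j|
      ≤ (1 / (p : ℝ)) * ∑ j ∈ Finset.Icc 1 p,
          (p : ℝ) ^ (ζ - 2 / 3) * ((min j (p + 1 - j) : ℕ) : ℝ) ^ (-(1 : ℝ) / 3) := by
        gcongr with j hj
        rw [Finset.mem_Icc] at hj
        exact hh j hj.1 hj.2
    _ ≤ (1 / (p : ℝ)) * ((p : ℝ) ^ (ζ - 2 / 3) * (3 * (p : ℝ) ^ ((2 : ℝ) / 3))) := by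
        rw [← Finset.mul_sum]
        gcongr
        exact sum_min_rpow_neg_third_le p
    _ = 3 * ((p : ℝ) ^ (ζ - 2 / 3) * (p : ℝ) ^ ((2 : ℝ) / 3) * (p : ℝ) ^ (-1 : ℝ)) := by
        rw [Real.rpow_neg_one]; ring
    _ = 3 * (p : ℝ) ^ (ζ - 1) := by
        rw [← Real.rpow_add hp', ← Real.rpow_add hp']
        congr 2; ring

/-- An eventual uniform gap between the root and the left edge, and a lower bound on the root. -/
theorem exists_eventually_root_bounds (m n : ℕ → ℕ) (d₁ d₂ : ℝ)
    (hd₁ : d₁ ∈ Set.Ioo (0 : ℝ) 1) (hd₂ : 0 < d₂)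
    (hm : Tendsto (fun p : ℕ => (p : ℝ) / m p) atTop (nhds d₁))
    (hn : Tendsto (fun p : ℕ => (p : ℝ) / n p) atTop (nhds d₂))
    (γq : ℕ → ℕ → ℝ)
    (hγq : ∀ᶠ p : ℕ in atTop,
      γq p 0 = bMP ((p : ℝ) / m p) ∧ γq p p = aMP ((p : ℝ) / m p) ∧
      ∀ j, 1 ≤ j → j ≤ p - 1 →
        γq p j ∈ Set.Ioo (aMP ((p : ℝ) / m p)) (bMP ((p : ℝ) / m p)) ∧
        (∫ x in (γq p j)..(bMP ((p : ℝ) / m p)), rhoMP ((p : ℝ) / m p) x) = (j : ℝ) / p)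
    (c₀ : ℕ → ℝ)
    (hc₀ : ∀ᶠ p : ℕ in atTop,
      c₀ p ∈ Set.Ioo 0 (aMP ((p : ℝ) / m p)) ∧
      (1 / (p : ℝ)) * ∑ j ∈ Finset.Icc 1 p, (c₀ p / (γq p j - c₀ p)) ^ 2 = (n p : ℝ) / p) :
    ∃ δ l : ℝ, 0 < δ ∧ 0 < l ∧ ∀ᶠ p : ℕ in atTop,
      aMP ((p : ℝ) / m p) ≤ 1 ∧ l ≤ c₀ p ∧ c₀ p + 4 * δ ≤ aMP ((p : ℝ) / m p) ∧
      γq p p = aMP ((p : ℝ) / m p) ∧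
      ∀ j ∈ Finset.Icc 1 p, γq p j ∈ Set.Icc (aMP ((p : ℝ) / m p)) 4 := by
  obtain ⟨h0, h1⟩ := hd₁
  set α := aMP d₁
  have hα0 : 0 < α := aMP_pos h1
  set l := Real.sqrt (d₁ / 2)
  have hl0 : 0 < l := Real.sqrt_pos.2 (by linarith)
  have hl1 : l ≤ 1 := Real.sqrt_le_one.2 (by linarith)
  have hα1 : α ≤ 1 := aMP_le_one h1
  have hcl : 0 < Real.sqrt l * α ^ 2 / (1024 * Real.pi) := by
    have := Real.sqrt_pos.2 hl0
    positivity
  obtain ⟨τ, hτ0, hτl, hτα, hτ⟩ : ∃ τ : ℝ, 0 < τ ∧ τ ^ 2 < 2 * l ∧ 4 * τ ^ 2 < α ∧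
      2 / d₂ * τ < Real.sqrt l * α ^ 2 / (1024 * Real.pi) := by
    have ev : ∀ f : ℝ → ℝ, Continuous f → f 0 = 0 → ∀ r > 0, ∀ᶠ τ in nhdsWithin 0 (Set.Ioi 0),
        f τ < r := fun f hf hf0 r hr =>
      (hf.continuousAt.tendsto.mono_left nhdsWithin_le_nhds).eventually
        (by rw [hf0]; exact gt_mem_nhds hr)
    have hpos : ∀ᶠ τ : ℝ in nhdsWithin 0 (Set.Ioi 0), 0 < τ := self_mem_nhdsWithin
    exact (hpos.and ((ev (fun τ => τ ^ 2) (by fun_prop) (by simp) (2 * l) (by linarith)).and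
      ((ev (fun τ => 4 * τ ^ 2) (by fun_prop) (by simp) α hα0).and
        (ev (fun τ => 2 / d₂ * τ) (by fun_prop) (by simp) _ hcl)))).exists
  have hs0 : 0 < τ ^ 2 := by positivity
  refine ⟨τ ^ 2 / 4, τ ^ 2 * Real.sqrt (1 / (2 * d₂)), by positivity,
    mul_pos hs0 (Real.sqrt_pos.2 (by positivity)), ?_⟩
  have haMP : Tendsto (fun p : ℕ => aMP ((p : ℝ) / m p)) atTop (nhds α) := by
    have : Continuous aMP := by unfold aMP; fun_prop
    exact (this.tendsto d₁).comp hm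
  have hn' : Tendsto (fun p : ℕ => (n p : ℝ) / p) atTop (nhds d₂⁻¹) := by
    simpa only [inv_div] using hn.inv₀ hd₂.ne'
  have hν1 : d₂⁻¹ < 2 / d₂ := by
    rw [inv_eq_one_div]; gcongr; norm_num
  have hν0 : 1 / (2 * d₂) < d₂⁻¹ := by
    rw [inv_eq_one_div]; gcongr; linarith
  filter_upwards [hγq, hc₀, hm.eventually (lt_mem_nhds (by linarith : d₁ / 2 < d₁)),
    hm.eventually (gt_mem_nhds h1), haMP.eventually (lt_mem_nhds (by linarith : α / 2 < α)),
    hn'.eventually (gt_mem_nhds hν1), hn'.eventually (lt_mem_nhds hν0), eventually_gt_atTop 0]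
    with p ⟨_, hgp, hg⟩ ⟨hc, hceq⟩ hdl hdu hap hνu hνl hp
  set d := (p : ℝ) / m p
  have hd0 : 0 < d := by linarith
  have hga : ∀ j ∈ Finset.Icc 1 p, γq p j ∈ Set.Icc (aMP d) 4 := fun j hj => by
    rw [Finset.mem_Icc] at hj
    have hb := bMP_le_four hdu
    have hab := aMP_lt_bMP hd0
    rcases hj.2.eq_or_lt with rfl | hlt
    · exact ⟨hgp.ge, by linarith⟩
    · have := (hg j hj.1 (by omega)).1
      exact ⟨this.1.le, by linarith [this.2]⟩
  have hld : l ≤ Real.sqrt d := Real.sqrt_le_sqrt hdl.le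
  have hsq : Real.sqrt (l * τ ^ 2) = Real.sqrt l * τ := by
    rw [Real.sqrt_mul hl0.le, Real.sqrt_sq hτ0.le]
  have hκ := le_integral_rhoMP_left_edge hd0 hdu hld hs0 hτl.le
  rw [hsq] at hκ
  have hgap : c₀ p + τ ^ 2 ≤ aMP d := by
    refine root_add_le_aMP hp hd0 hdu hs0 (by positivity) ?_ hκ hgp hg hc (by linarith) hceq ?_
    · have hτ1 : τ ≤ 1 := by nlinarith
      have hsl1 : Real.sqrt l ≤ 1 := Real.sqrt_le_one.2 hl1
      have hprod : τ ^ 2 * (Real.sqrt l * τ) ≤ 1 :=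
        mul_le_one₀ (by nlinarith) (by positivity) (mul_le_one₀ hsl1 hτ0.le hτ1)
      rw [div_le_one (by positivity)]
      nlinarith [Real.pi_gt_three]
    · calc (n p : ℝ) / p < 2 / d₂ := hνu
        _ ≤ Real.sqrt l * α ^ 2 / (1024 * Real.pi) / τ := by
          rw [le_div_iff₀ hτ0]; exact hτ.le
        _ = τ ^ 2 * (Real.sqrt l * τ) / (16 * Real.pi) * ((α / 2) / (4 * τ ^ 2)) ^ 2 := by
          field_simp; norm_num
        _ ≤ _ := by gcongr
  exact ⟨aMP_le_one hdu, mul_sqrt_le_root hp hs0 hc.1 hgap (fun j hj => (hga j hj).1) hceq hνl.le,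
    by linarith, hgp, hga⟩

theorem tendsto_natCast_rpow_of_neg {y : ℝ} (hy : y < 0) :
    Tendsto (fun p : ℕ => (p : ℝ) ^ y) atTop (nhds 0) := by
  simpa [Function.comp_def] using
    (tendsto_rpow_neg_atTop (neg_pos.2 hy)).comp tendsto_natCast_atTop_atTop

/-- under Condition 3 with `0 < d₁ < 1`, there exists `ζ₀ > 0` such that
for every `ζ ∈ (0, ζ₀)`, for all large `p`: whenever `γ̂_1 ≥ … ≥ γ̂_p > 0` satisfy
`|γ̂_j − γ_j| ≤ p^{ζ−2/3}(min(j, p+1−j))^{−1/3}` for all `1 ≤ j ≤ p`, there exists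
`ĉ_p ∈ (0, γ̂_p)` with `(1/p)Σ_{j=1}^p (ĉ_p/(γ̂_j − ĉ_p))² = n/p`,
`c_{p,0} − p^{−1/2} < ĉ_p < c_{p,0} + p^{−1/2}`, `|c_{p,0} − ĉ_p| ≤ M·p^{ζ−1}`,
and uniformly `ĉ_p/(γ̂_p − ĉ_p) ≤ K` and `ĉ_p/γ̂_p ≤ r < 1`. -/
theorem stmt_10 (m n : ℕ → ℕ) (d₁ d₂ d₃ : ℝ)
    (hd₁ : d₁ ∈ Set.Ioo (0 : ℝ) 1) (hd₂ : 0 < d₂) (hd₃ : d₃ ∈ Set.Ioo (0 : ℝ) 1)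
    (hm : Tendsto (fun p : ℕ => (p : ℝ) / m p) atTop (nhds d₁))
    (hn : Tendsto (fun p : ℕ => (p : ℝ) / n p) atTop (nhds d₂))
    (hmn : Tendsto (fun p : ℕ => (p : ℝ) / ((m p : ℝ) + n p)) atTop (nhds d₃))
    (γq : ℕ → ℕ → ℝ)
    (hγq : ∀ᶠ p : ℕ in atTop,
      γq p 0 = bMP ((p : ℝ) / m p) ∧ γq p p = aMP ((p : ℝ) / m p) ∧
      ∀ j, 1 ≤ j → j ≤ p - 1 →
        γq p j ∈ Set.Ioo (aMP ((p : ℝ) / m p)) (bMP ((p : ℝ) / m p)) ∧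
        (∫ x in (γq p j)..(bMP ((p : ℝ) / m p)), rhoMP ((p : ℝ) / m p) x) = (j : ℝ) / p)
    (c₀ : ℕ → ℝ)
    (hc₀ : ∀ᶠ p : ℕ in atTop,
      c₀ p ∈ Set.Ioo 0 (aMP ((p : ℝ) / m p)) ∧
      (1 / (p : ℝ)) * ∑ j ∈ Finset.Icc 1 p, (c₀ p / (γq p j - c₀ p)) ^ 2 = (n p : ℝ) / p) :
    ∃ ζ₀ : ℝ, 0 < ζ₀ ∧ ∀ ζ ∈ Set.Ioo 0 ζ₀,
      ∃ M K r : ℝ, r < 1 ∧ ∀ᶠ p : ℕ in atTop,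
        ∀ γh : ℕ → ℝ,
          (∀ j k : ℕ, 1 ≤ j → j ≤ k → k ≤ p → γh k ≤ γh j) →
          0 < γh p →
          (∀ j, 1 ≤ j → j ≤ p →
            |γh j - γq p j| ≤ (p : ℝ) ^ (ζ - 2 / 3) * ((min j (p + 1 - j) : ℕ) : ℝ) ^ (-(1 : ℝ) / 3)) →
          ∃ ch ∈ Set.Ioo 0 (γh p),
            (1 / (p : ℝ)) * ∑ j ∈ Finset.Icc 1 p, (ch / (γh j - ch)) ^ 2 = (n p : ℝ) / p ∧
            c₀ p - (p : ℝ) ^ (-(1 : ℝ) / 2) < ch ∧ ch < c₀ p + (p : ℝ) ^ (-(1 : ℝ) / 2) ∧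
            |c₀ p - ch| ≤ M * (p : ℝ) ^ (ζ - 1) ∧
            ch / (γh p - ch) ≤ K ∧ ch / γh p ≤ r := by
  obtain ⟨δ, l, hδ, hl, hev⟩ :=
    exists_eventually_root_bounds m n d₁ d₂ hd₁ hd₂ hm hn γq hγq c₀ hc₀
  refine ⟨1 / 2, by norm_num, fun ζ hζ => ?_⟩
  obtain ⟨hζ0, hζ1⟩ := hζ
  set M : ℝ := 16 / (l * δ ^ 3) * 3
  refine ⟨M, 1 / (2 * δ), 1 / (1 + 2 * δ), ?_, ?_⟩
  · rw [div_lt_one (by positivity)]; linarith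
  have ht : Tendsto (fun p : ℕ => M * (p : ℝ) ^ (ζ - 1)) atTop (nhds 0) := by
    simpa using (tendsto_natCast_rpow_of_neg (by linarith : ζ - 1 < 0)).const_mul M
  have ht' : Tendsto (fun p : ℕ => M * (p : ℝ) ^ (ζ - 1 / 2)) atTop (nhds 0) := by
    simpa using (tendsto_natCast_rpow_of_neg (by linarith : ζ - 1 / 2 < 0)).const_mul M
  have hM0 : 0 < M := by positivity
  filter_upwards [hev, hc₀, ht.eventually (gt_mem_nhds hδ), ht.eventually (gt_mem_nhds hl),
    ht'.eventually (gt_mem_nhds one_pos),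
    (tendsto_natCast_rpow_of_neg (by linarith : ζ - 2 / 3 < 0)).eventually (gt_mem_nhds hδ),
    eventually_gt_atTop 0]
    with p ⟨ha1, hlc, hca, hgp, hg⟩ ⟨_, hceq⟩ htδ htl htp hpδ hp γh _ _ hclose
  have hp' : (0 : ℝ) < p := by exact_mod_cast hp
  have hunif : ∀ j ∈ Finset.Icc 1 p, |γh j - γq p j| ≤ δ := fun j hj => by
    rw [Finset.mem_Icc] at hj
    refine (hclose j hj.1 hj.2).trans (le_trans ?_ hpδ.le)
    refine mul_le_of_le_one_right (by positivity)
      (Real.rpow_le_one_of_one_le_of_nonpos ?_ (by norm_num))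
    have : 1 ≤ min j (p + 1 - j) := by omega
    exact_mod_cast this
  obtain ⟨x, ⟨hx1, hx2⟩, hxeq⟩ := exists_perturbed_root hp hδ hl ha1 hlc hca hg hunif
    (mean_abs_sub_le hp hclose) (by positivity : 0 ≤ M * (p : ℝ) ^ (ζ - 1)) htδ.le htl
    (by rw [← mul_assoc]) hceq
  have hhalf : M * (p : ℝ) ^ (ζ - 1) < (p : ℝ) ^ (-(1 : ℝ) / 2) := by
    have : M * (p : ℝ) ^ (ζ - 1) = M * (p : ℝ) ^ (ζ - 1 / 2) * (p : ℝ) ^ (-(1 : ℝ) / 2) := by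
      rw [mul_assoc M, ← Real.rpow_add hp']
      congr 2; ring
    rw [this]
    exact mul_lt_of_lt_one_left (by positivity) htp
  have hlast := (abs_le.1 (hunif p (Finset.mem_Icc.2 ⟨hp, le_rfl⟩))).1
  rw [hgp] at hlast
  have hx0 : 0 < x := by linarith
  have hxh : 2 * δ ≤ γh p - x := by linarith
  have hx1' : x ≤ 1 := by linarith
  refine ⟨x, ⟨hx0, by linarith⟩, hxeq, by linarith, by linarith,
    abs_le.2 ⟨by linarith, by linarith⟩, ?_, ?_⟩
  · exact div_le_div₀ zero_le_one hx1' (by positivity) hxh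
  · rw [div_le_div_iff₀ (by linarith) (by positivity)]
    nlinarith
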